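/- arXiv:2401.06368 — 6 statements merged into one kernel-verified Lean document; each statement's English description precedes it below -/
import Mathlib

section
/- Let L be a nondegenerate integral quadratic ℤ_p-lattice of rank n and M an integral quadratic ℤ_p-lattice of rank m. Then there exist natural numbers m₀ and d₀ such that for every a ∈ ℤ_p with p-adic valuation v_p(a) ≥ m₀ and every integer d ≥ d₀ one has the exact counting identity #Rep_{⟨a⟩⊥M, L}(ℤ/p^d) = p^{n·d} · #Rep_{M, L}(ℤ/p^d). -/
open Filter Topology

namespace PaperStmt

/-- Reduction mod `p^d` of a quadratic form on `ℤ_p^n` (induced form on `(ℤ/p^d)^n`). -/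
noncomputable def qRed (p : ℕ) [Fact p.Prime] (d : ℕ) {n : ℕ}
    (Q : QuadraticForm ℤ_[p] (Fin n → ℤ_[p])) (x : Fin n → ZMod (p ^ d)) : ZMod (p ^ d) :=
  PadicInt.toZModPow d (Q fun i => ((x i).val : ℤ_[p]))

/-- `Rep_{M,L}(ℤ/p^d)`: module homomorphisms (encoded as matrices) preserving the induced
quadratic forms. -/
noncomputable def RepSet (p : ℕ) [Fact p.Prime] {m n : ℕ}
    (QM : QuadraticForm ℤ_[p] (Fin m → ℤ_[p])) (QL : QuadraticForm ℤ_[p] (Fin n → ℤ_[p]))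
    (d : ℕ) : Set (Matrix (Fin m) (Fin n) (ZMod (p ^ d))) :=
  {T | ∀ x : Fin n → ZMod (p ^ d), qRed p d QM (T.mulVec x) = qRed p d QL x}

/-- `PRep_{M,L}(ℤ/p^d)`: those elements of `Rep` that are isomorphisms onto a direct summand
(equivalently, split injections, i.e. left invertible). -/
noncomputable def PRepSet (p : ℕ) [Fact p.Prime] {m n : ℕ}
    (QM : QuadraticForm ℤ_[p] (Fin m → ℤ_[p])) (QL : QuadraticForm ℤ_[p] (Fin n → ℤ_[p]))
    (d : ℕ) : Set (Matrix (Fin m) (Fin n) (ZMod (p ^ d))) :=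
  {T | T ∈ RepSet p QM QL d ∧ ∃ S : Matrix (Fin n) (Fin m) (ZMod (p ^ d)), S * T = 1}

/-- The local density `Den(M,L)` exists and equals `D`. -/
noncomputable def HasDen (p : ℕ) [Fact p.Prime] {m n : ℕ}
    (QM : QuadraticForm ℤ_[p] (Fin m → ℤ_[p])) (QL : QuadraticForm ℤ_[p] (Fin n → ℤ_[p]))
    (D : ℝ) : Prop :=
  Tendsto (fun d : ℕ =>
      ((RepSet p QM QL d).ncard : ℝ) / (p : ℝ) ^ ((d : ℤ) * ((m : ℤ) * n - n * (n + 1) / 2)))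
    atTop (𝓝 D)

/-- The primitive local density `Pden(M,L)` exists and equals `D`. -/
noncomputable def HasPden (p : ℕ) [Fact p.Prime] {m n : ℕ}
    (QM : QuadraticForm ℤ_[p] (Fin m → ℤ_[p])) (QL : QuadraticForm ℤ_[p] (Fin n → ℤ_[p]))
    (D : ℝ) : Prop :=
  Tendsto (fun d : ℕ =>
      ((PRepSet p QM QL d).ncard : ℝ) / (p : ℝ) ^ ((d : ℤ) * ((m : ℤ) * n - n * (n + 1) / 2)))
    atTop (𝓝 D)

/-- The rank one quadratic lattice `⟨a⟩`, i.e. `ℤ_p` with the form `x ↦ a·x²`. -/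
noncomputable def diagLat (p : ℕ) [Fact p.Prime] (a : ℤ_[p]) :
    QuadraticForm ℤ_[p] (Fin 1 → ℤ_[p]) :=
  LinearMap.BilinMap.toQuadraticMap
    ((LinearMap.mul ℤ_[p] ℤ_[p]).compl₁₂ (a • LinearMap.proj 0) (LinearMap.proj 0))

/-- Orthogonal direct sum of quadratic lattices. -/
noncomputable def orthSum (p : ℕ) [Fact p.Prime] {m₁ m₂ : ℕ}
    (Q₁ : QuadraticForm ℤ_[p] (Fin m₁ → ℤ_[p])) (Q₂ : QuadraticForm ℤ_[p] (Fin m₂ → ℤ_[p])) :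
    QuadraticForm ℤ_[p] (Fin (m₁ + m₂) → ℤ_[p]) :=
  (QuadraticMap.prod Q₁ Q₂).comp
    ((LinearEquiv.funCongrLeft ℤ_[p] ℤ_[p] finSumFinEquiv).trans
      (LinearEquiv.sumArrowLequivProdArrow (Fin m₁) (Fin m₂) ℤ_[p] ℤ_[p])).toLinearMap

/-- The self-dual lattice `H_{2K}^+ = (H_2^+)^{⊥ K}`, with form `x ↦ Σ_i x_{2i}·x_{2i+1}`. -/
noncomputable def Hplus (p : ℕ) [Fact p.Prime] (K : ℕ) :
    QuadraticForm ℤ_[p] (Fin (2 * K) → ℤ_[p]) :=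
  LinearMap.BilinMap.toQuadraticMap
    (∑ i : Fin K, (LinearMap.mul ℤ_[p] ℤ_[p]).compl₁₂
      (LinearMap.proj ⟨2 * i.1, by have := i.2; omega⟩)
      (LinearMap.proj ⟨2 * i.1 + 1, by have := i.2; omega⟩))

/-- Nondegeneracy of a quadratic lattice (the Gram matrix of the polar form has nonzero
determinant, equivalently the form is nondegenerate over `ℚ_p`). -/
def NondegQF (p : ℕ) [Fact p.Prime] {n : ℕ}
    (Q : QuadraticForm ℤ_[p] (Fin n → ℤ_[p])) : Prop :=
  (Matrix.of fun i j : Fin n =>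
    QuadraticMap.polar (⇑Q) (Pi.single i 1) (Pi.single j 1)).det ≠ 0

/-- Reduction of a quadratic form is computed by any lift. -/
theorem qRed_toZModPow (p : ℕ) [Fact p.Prime] (d : ℕ) {n : ℕ}
    (Q : QuadraticForm ℤ_[p] (Fin n → ℤ_[p])) (x : Fin n → ℤ_[p]) :
    qRed p d Q (fun i => PadicInt.toZModPow d (x i)) = PadicInt.toZModPow d (Q x) := by
  have h : ∀ i, ∃ y, ((PadicInt.toZModPow d (x i)).val : ℤ_[p]) = x i + (p : ℤ_[p]) ^ d * y := by
    intro i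
    have : ((PadicInt.toZModPow d (x i)).val : ℤ_[p]) - x i ∈
        RingHom.ker (PadicInt.toZModPow d : ℤ_[p] →+* ZMod (p ^ d)) := by
      simp [RingHom.mem_ker]
    rw [PadicInt.ker_toZModPow, Ideal.mem_span_singleton] at this
    obtain ⟨y, hy⟩ := this
    exact ⟨y, by rw [← hy]; ring⟩
  choose y hy using h
  have hxy : (fun i => ((PadicInt.toZModPow d (x i)).val : ℤ_[p])) =
      x + (p : ℤ_[p]) ^ d • y := by
    ext1 i
    simp [hy i]
  have hp : PadicInt.toZModPow d ((p : ℤ_[p]) ^ d) = 0 := by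
    rw [← RingHom.mem_ker, PadicInt.ker_toZModPow]
    exact Ideal.mem_span_singleton_self _
  rw [qRed, hxy, QuadraticMap.map_add Q, QuadraticMap.map_smul, QuadraticMap.polar_smul_right]
  simp only [smul_eq_mul, map_add, map_mul, hp, zero_mul, add_zero]

theorem exists_toZModPow_eq (p : ℕ) [Fact p.Prime] (d : ℕ) {n : ℕ}
    (x : Fin n → ZMod (p ^ d)) :
    ∃ y : Fin n → ℤ_[p], x = fun i => PadicInt.toZModPow d (y i) :=
  ⟨fun i => ((x i).val : ℤ_[p]), by ext1 i; simp⟩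

theorem diagLat_apply (p : ℕ) [Fact p.Prime] (a : ℤ_[p]) (x : Fin 1 → ℤ_[p]) :
    diagLat p a x = a * x 0 ^ 2 := by
  simp [diagLat]
  ring

theorem orthSum_apply (p : ℕ) [Fact p.Prime] {m₁ m₂ : ℕ}
    (Q₁ : QuadraticForm ℤ_[p] (Fin m₁ → ℤ_[p])) (Q₂ : QuadraticForm ℤ_[p] (Fin m₂ → ℤ_[p]))
    (x : Fin (m₁ + m₂) → ℤ_[p]) :
    orthSum p Q₁ Q₂ x =
      Q₁ (fun i => x (Fin.castAdd m₂ i)) + Q₂ (fun i => x (Fin.natAdd m₁ i)) := by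
  rfl

theorem qRed_orthSum_diagLat (p : ℕ) [Fact p.Prime] (d : ℕ) {m : ℕ} (a : ℤ_[p])
    (Q : QuadraticForm ℤ_[p] (Fin m → ℤ_[p])) (x : Fin (1 + m) → ZMod (p ^ d)) :
    qRed p d (orthSum p (diagLat p a) Q) x =
      PadicInt.toZModPow d a * x (Fin.castAdd m (0 : Fin 1)) ^ 2 +
        qRed p d Q (fun i => x (Fin.natAdd 1 i)) := by
  obtain ⟨y, rfl⟩ := exists_toZModPow_eq p d x
  rw [qRed_toZModPow, qRed_toZModPow p d Q (fun i => y (Fin.natAdd 1 i)), orthSum_apply,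
    diagLat_apply]
  simp

theorem polar_eq_dotProduct_mulVec {R : Type*} [CommRing R] {n : ℕ}
    (Q : QuadraticForm R (Fin n → R)) (x y : Fin n → R) :
    QuadraticMap.polar Q x y = x ⬝ᵥ (Matrix.of fun i j : Fin n =>
      QuadraticMap.polar (⇑Q) (Pi.single i 1) (Pi.single j 1)).mulVec y := by
  have h : (Matrix.of fun i j : Fin n =>
      QuadraticMap.polar (⇑Q) (Pi.single i 1) (Pi.single j 1)) =
        LinearMap.toMatrix₂' R Q.polarBilin := by
    ext i j
    simp [LinearMap.toMatrix₂'_apply]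
  rw [h, ← Matrix.toLinearMap₂'_apply', Matrix.toLinearMap₂'_toMatrix']
  rfl

/-- A quadratic equation `q e² + e + p b = 0` has a solution in `p ℤ_p`. -/
theorem exists_dvd_root (p : ℕ) [Fact p.Prime] (q b : ℤ_[p]) :
    ∃ e : ℤ_[p], (p : ℤ_[p]) ∣ e ∧ q * e ^ 2 + e + p * b = 0 := by
  let F : Polynomial ℤ_[p] :=
    Polynomial.C q * Polynomial.X ^ 2 + Polynomial.X + Polynomial.C (p * b)
  have h0 : F.aeval (0 : ℤ_[p]) = p * b := by simp [F]
  have h1 : F.derivative.aeval (0 : ℤ_[p]) = 1 := by simp [F]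
  have hb : ‖(p : ℤ_[p]) * b‖ < 1 := (PadicInt.norm_lt_one_iff_dvd _).2 ⟨b, rfl⟩
  obtain ⟨e, he, hlt, -⟩ := hensels_lemma (F := F) (a := (0 : ℤ_[p]))
    (by rw [h0, h1]; simpa using hb)
  refine ⟨e, ?_, by simpa [F] using he⟩
  rw [h1, sub_zero, norm_one] at hlt
  exact (PadicInt.norm_lt_one_iff_dvd _).1 hlt

/-- Subtracting a highly divisible multiple of the square of a linear form from a nondegenerate
quadratic form gives an isometric form. -/
theorem exists_isUnit_comp_eq_sub (p : ℕ) [Fact p.Prime] {n : ℕ}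
    (Q : QuadraticForm ℤ_[p] (Fin n → ℤ_[p])) (b : ℤ_[p]) (u : Fin n → ℤ_[p]) :
    ∃ g : Matrix (Fin n) (Fin n) ℤ_[p], IsUnit g ∧ ∀ x,
      Q (g.mulVec x) = Q x - (Matrix.of fun i j : Fin n =>
        QuadraticMap.polar (⇑Q) (Pi.single i 1) (Pi.single j 1)).det ^ 2 * (p * b) *
          (u ⬝ᵥ x) ^ 2 := by
  set B := Matrix.of fun i j : Fin n =>
    QuadraticMap.polar (⇑Q) (Pi.single i 1) (Pi.single j 1) with hB
  set w := B.adjugate.mulVec u with hw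
  obtain ⟨e, ⟨f, rfl⟩, he⟩ := exists_dvd_root p (Q w) b
  refine ⟨1 + Matrix.vecMulVec ((B.det * (p * f)) • w) u, ?_, fun x => ?_⟩
  · rw [Matrix.isUnit_iff_isUnit_det, Matrix.vecMulVec_eq Unit,
      Matrix.det_one_add_replicateCol_mul_replicateRow]
    have : ‖u ⬝ᵥ ((B.det * (p * f)) • w)‖ < 1 := by
      refine (PadicInt.norm_lt_one_iff_dvd _).2 ⟨B.det * f * (u ⬝ᵥ w), ?_⟩
      rw [dotProduct_smul, smul_eq_mul]
      ring
    have hmem : -(u ⬝ᵥ ((B.det * (p * f)) • w)) ∈ nonunits ℤ_[p] := by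
      rwa [PadicInt.mem_nonunits, norm_neg]
    simpa using IsLocalRing.isUnit_one_sub_self_of_mem_nonunits _ hmem
  · have hx : (1 + Matrix.vecMulVec ((B.det * (p * f)) • w) u).mulVec x =
        x + (B.det * (p * f) * (u ⬝ᵥ x)) • w := by
      rw [Matrix.add_mulVec, Matrix.one_mulVec, Matrix.vecMulVec_mulVec]
      ext i
      simp
      ring
    have hpol : QuadraticMap.polar Q x w = B.det * (u ⬝ᵥ x) := by
      rw [polar_eq_dotProduct_mulVec, ← hB, hw, Matrix.mulVec_mulVec, Matrix.mul_adjugate,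
        Matrix.smul_mulVec, Matrix.one_mulVec, dotProduct_smul, smul_eq_mul, dotProduct_comm]
    rw [hx, QuadraticMap.map_add Q, QuadraticMap.map_smul, QuadraticMap.polar_smul_right, hpol]
    simp only [smul_eq_mul]
    linear_combination (B.det ^ 2 * (u ⬝ᵥ x) ^ 2) * he

theorem exists_dvd_prime_pow (p : ℕ) [Fact p.Prime] {x : ℤ_[p]} (hx : x ≠ 0) :
    ∃ k : ℕ, x ∣ (p : ℤ_[p]) ^ k := by
  obtain ⟨k, hk⟩ := IsDiscreteValuationRing.associated_pow_irreducible hx PadicInt.irreducible_p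
  exact ⟨k, hk.dvd⟩

theorem exists_isUnit_qRed_mulVec (p : ℕ) [Fact p.Prime] {n : ℕ}
    (Q : QuadraticForm ℤ_[p] (Fin n → ℤ_[p])) (hQ : NondegQF p Q) :
    ∃ m₀ : ℕ, ∀ a : ℤ_[p], (p : ℤ_[p]) ^ m₀ ∣ a → ∀ (d : ℕ) (u : Fin n → ZMod (p ^ d)),
      ∃ g : Matrix (Fin n) (Fin n) (ZMod (p ^ d)), IsUnit g ∧ ∀ x,
        PadicInt.toZModPow d a * (u ⬝ᵥ x) ^ 2 + qRed p d Q (g.mulVec x) = qRed p d Q x := by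
  obtain ⟨k, c, hc⟩ := exists_dvd_prime_pow p hQ
  refine ⟨2 * k + 1, ?_⟩
  rintro a ⟨b, rfl⟩ d u
  obtain ⟨v, rfl⟩ := exists_toZModPow_eq p d u
  obtain ⟨g, hg, hgQ⟩ := exists_isUnit_comp_eq_sub p Q (c ^ 2 * b) v
  set D := (Matrix.of fun i j : Fin n =>
    QuadraticMap.polar (⇑Q) (Pi.single i 1) (Pi.single j 1)).det
  have ha : (p : ℤ_[p]) ^ (2 * k + 1) * b = D ^ 2 * (p * (c ^ 2 * b)) := by
    rw [pow_succ, mul_comm 2 k, pow_mul, hc]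
    ring
  rw [← ha] at hgQ
  refine ⟨(PadicInt.toZModPow d).mapMatrix g, hg.map _, fun x => ?_⟩
  obtain ⟨y, rfl⟩ := exists_toZModPow_eq p d x
  have hgy : ((PadicInt.toZModPow d).mapMatrix g).mulVec
      (fun i => PadicInt.toZModPow d (y i)) = fun i => PadicInt.toZModPow d (g.mulVec y i) := by
    ext i
    simp [Matrix.mulVec, dotProduct]
  have hvy : (fun i => PadicInt.toZModPow d (v i)) ⬝ᵥ (fun i => PadicInt.toZModPow d (y i)) =
      PadicInt.toZModPow d (v ⬝ᵥ y) := by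
    simp [dotProduct]
  rw [hgy, hvy, qRed_toZModPow, qRed_toZModPow, hgQ, ← map_pow, ← map_mul, ← map_add]
  congr 1
  ring

/-- For `L` nondegenerate of rank `n` and `M` integral of rank `m`, there are
`m₀ d₀` such that for all `a ∈ ℤ_p` with `v_p(a) ≥ m₀` (i.e. `p^m₀ ∣ a`) and all `d ≥ d₀`,
`#Rep_{⟨a⟩⊥M, L}(ℤ/p^d) = p^{n·d} · #Rep_{M, L}(ℤ/p^d)`. -/
theorem statement0 (p : ℕ) [Fact p.Prime] (n m : ℕ)
    (QL : QuadraticForm ℤ_[p] (Fin n → ℤ_[p])) (QM : QuadraticForm ℤ_[p] (Fin m → ℤ_[p]))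
    (hQL : NondegQF p QL) :
    ∃ m₀ d₀ : ℕ, ∀ a : ℤ_[p], (p : ℤ_[p]) ^ m₀ ∣ a → ∀ d : ℕ, d₀ ≤ d →
      (RepSet p (orthSum p (diagLat p a) QM) QL d).ncard
        = p ^ (n * d) * (RepSet p QM QL d).ncard := by
  obtain ⟨m₀, hm₀⟩ := exists_isUnit_qRed_mulVec p QL hQL
  refine ⟨m₀, 0, fun a ha d _ => ?_⟩
  choose g hg hgQ using hm₀ a ha d
  let f : (Fin n → ZMod (p ^ d)) × Matrix (Fin m) (Fin n) (ZMod (p ^ d)) →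
      Matrix (Fin (1 + m)) (Fin n) (ZMod (p ^ d)) :=
    fun uT => Matrix.of (Fin.append (fun _ : Fin 1 => uT.1) (uT.2 * g uT.1))
  have hf0 : ∀ uT, f uT (Fin.castAdd m (0 : Fin 1)) = uT.1 := fun uT =>
    Fin.append_left (fun _ : Fin 1 => uT.1) (uT.2 * g uT.1) 0
  have hf1 : ∀ uT i, f uT (Fin.natAdd 1 i) = (uT.2 * g uT.1) i := fun uT i =>
    Fin.append_right (fun _ => uT.1) (uT.2 * g uT.1) i
  have hinj : Function.Injective f := by
    rintro ⟨u, T⟩ ⟨u', T'⟩ h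
    obtain rfl : u = u' := (hf0 (u, T)).symm.trans (h ▸ hf0 (u', T'))
    have : T * g u = T' * g u := by
      funext i
      exact (hf1 (u, T) i).symm.trans (h ▸ hf1 (u, T') i)
    obtain ⟨h, hh⟩ := (hg u).exists_right_inv
    have := congrArg (· * h) this
    simp only [Matrix.mul_assoc, hh, Matrix.mul_one] at this
    rw [this]
  have hmem : ∀ uT, f uT ∈ RepSet p (orthSum p (diagLat p a) QM) QL d ↔
      uT.2 ∈ RepSet p QM QL d := by
    rintro ⟨u, T⟩
    have key : ∀ x, qRed p d (orthSum p (diagLat p a) QM) ((f (u, T)).mulVec x) = qRed p d QL x ↔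
        qRed p d QM (T.mulVec ((g u).mulVec x)) = qRed p d QL ((g u).mulVec x) := by
      intro x
      have h0 : (f (u, T)).mulVec x (Fin.castAdd m (0 : Fin 1)) = u ⬝ᵥ x := by
        rw [Matrix.mulVec, hf0]
      have h1 : (fun i => (f (u, T)).mulVec x (Fin.natAdd 1 i)) =
          T.mulVec ((g u).mulVec x) := by
        funext i
        rw [Matrix.mulVec_mulVec, Matrix.mulVec, hf1, Matrix.mulVec]
      rw [qRed_orthSum_diagLat, h0, h1, ← hgQ u x, add_right_inj]
    refine (forall_congr' key).trans ⟨fun h x => ?_, fun h x => h _⟩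
    obtain ⟨y, rfl⟩ := Matrix.mulVec_surjective_iff_isUnit.2 (hg u) x
    exact h y
  have himg : f '' (Set.univ ×ˢ RepSet p QM QL d) =
      RepSet p (orthSum p (diagLat p a) QM) QL d := by
    ext A
    constructor
    · rintro ⟨uT, ⟨-, hT⟩, rfl⟩
      exact (hmem uT).2 hT
    · intro hA
      obtain ⟨h, hh⟩ := (hg (A (Fin.castAdd m (0 : Fin 1)))).exists_left_inv
      have hfA : f (A (Fin.castAdd m (0 : Fin 1)), Matrix.of (fun i => A (Fin.natAdd 1 i)) * h) = A := by
        funext i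
        refine Fin.addCases (fun j => ?_) (fun j => ?_) i
        · rw [Subsingleton.elim j 0, hf0]
        · rw [hf1, Matrix.mul_assoc, hh, Matrix.mul_one]
          rfl
      exact ⟨_, ⟨Set.mem_univ _, (hmem _).1 (by rwa [hfA])⟩, hfA⟩
  rw [← himg, Set.ncard_image_of_injective _ hinj, Set.ncard_prod, Set.ncard_univ]
  simp [← pow_mul, mul_comm]

end PaperStmt
end

section
/- Let K ≥ 1 be an integer and N ∈ ℤ_p. If N ∈ pℤ_p, then Pden(H_{2K}^+, ⟨N⟩) = (1 − p^{−K})(1 + p^{1−K}); if N is a unit of ℤ_p, then Pden(H_{2K}^+, ⟨N⟩) = 1 − p^{−K}. In particular the limits defining these primitive local densities exist. -/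
open Filter Topology

namespace PaperStmt

section LocalRing

variable {R : Type*} [CommRing R] {ι : Type*} [Fintype ι]

/-- Translating along a coordinate where `y` is a unit identifies `J^ι` with `J` times the set of
vectors of `J^ι` whose pairing with `y` is `N`. -/
theorem card_pairing_fiber_mul (J : Ideal R) {y : ι → R} (hy : ∃ i, IsUnit (y i)) {N : R}
    (hN : N ∈ J) :
    Nat.card {x : ι → R // (∀ i, x i ∈ J) ∧ ∑ i, x i * y i = N} * Nat.card J =
      Nat.card J ^ Fintype.card ι := by
  classical
  obtain ⟨i₀, u, hu⟩ := hy
  have hpair (x : ι → R) (t : R) :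
      ∑ i, (x i + t * (Pi.single i₀ (↑u⁻¹ : R) : ι → R) i) * y i = ∑ i, x i * y i + t := by
    simp [add_mul, Finset.sum_add_distrib, Pi.single_apply, ← hu, mul_assoc]
  have hmem (x : ι → R) (hx : ∀ i, x i ∈ J) (t : R) (ht : t ∈ J) (i : ι) :
      x i + t * (Pi.single i₀ (↑u⁻¹ : R) : ι → R) i ∈ J :=
    J.add_mem (hx i) (J.mul_mem_right _ ht)
  have hsum (x : ι → R) (hx : ∀ i, x i ∈ J) : ∑ i, x i * y i ∈ J :=
    J.sum_mem fun i _ => J.mul_mem_right _ (hx i)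
  let e : {x : ι → R // (∀ i, x i ∈ J) ∧ ∑ i, x i * y i = N} × J ≃ (ι → J) :=
    { toFun := fun a i => ⟨_, hmem a.1.1 a.1.2.1 a.2 a.2.2 i⟩
      invFun := fun z =>
        ⟨⟨fun i => (z i : R) + (N - ∑ j, (z j : R) * y j) * (Pi.single i₀ (↑u⁻¹ : R) : ι → R) i,
          hmem _ (fun i => (z i).2) _ (J.sub_mem hN (hsum _ fun i => (z i).2)),
          by rw [hpair]; ring⟩,
          ⟨∑ j, (z j : R) * y j - N, J.sub_mem (hsum _ fun i => (z i).2) hN⟩⟩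
      left_inv := by
        rintro ⟨⟨x, hx, hxN⟩, t, ht⟩
        ext
        · simp only [hpair, hxN]; ring
        · simp only [hpair, hxN]; ring
      right_inv := fun z => by
        ext i
        simp only
        ring }
  rw [← Nat.card_prod, Nat.card_congr e, Nat.card_fun, Nat.card_eq_fintype_card (α := ι)]

variable [IsLocalRing R] [Finite R]

open IsLocalRing

theorem card_exists_isUnit :
    (Nat.card {x : ι → R // ∃ i, IsUnit (x i)} : ℝ) =
      (Nat.card R : ℝ) ^ Fintype.card ι - (Nat.card (maximalIdeal R) : ℝ) ^ Fintype.card ι := by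
  classical
  have h := Nat.card_congr (Equiv.sumCompl fun x : ι → R => ∃ i, IsUnit (x i))
  have e : {x : ι → R // ¬ ∃ i, IsUnit (x i)} ≃ (ι → maximalIdeal R) :=
    (Equiv.subtypeEquivRight fun x => by simp).trans
      (Equiv.subtypePiEquivPi (p := fun _ r => r ∈ maximalIdeal R))
  rw [Nat.card_sum, Nat.card_congr e, Nat.card_fun, Nat.card_fun,
    Nat.card_eq_fintype_card (α := ι)] at h
  rw [eq_sub_iff_add_eq]
  exact_mod_cast h

/-- Pairs `(x, y)` with `x ∈ J^ι`, `y` unimodular and pairing `N ∈ J`. -/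
theorem card_pairs_mul (J : Ideal R) {N : R} (hN : N ∈ J) :
    (Nat.card {a : (ι → R) × (ι → R) //
        (∃ i, IsUnit (a.2 i)) ∧ (∀ i, a.1 i ∈ J) ∧ ∑ i, a.1 i * a.2 i = N} : ℝ) * Nat.card J =
      ((Nat.card R : ℝ) ^ Fintype.card ι - (Nat.card (maximalIdeal R) : ℝ) ^ Fintype.card ι) *
        (Nat.card J : ℝ) ^ Fintype.card ι := by
  classical
  have := Fintype.ofFinite {y : ι → R // ∃ i, IsUnit (y i)}
  let e : {a : (ι → R) × (ι → R) //
        (∃ i, IsUnit (a.2 i)) ∧ (∀ i, a.1 i ∈ J) ∧ ∑ i, a.1 i * a.2 i = N} ≃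
      Σ y : {y : ι → R // ∃ i, IsUnit (y i)},
        {x : ι → R // (∀ i, x i ∈ J) ∧ ∑ i, x i * y.1 i = N} :=
    { toFun := fun a => ⟨⟨a.1.2, a.2.1⟩, ⟨a.1.1, a.2.2⟩⟩
      invFun := fun b => ⟨(b.2.1, b.1.1), b.1.2, b.2.2⟩
      left_inv := fun _ => rfl
      right_inv := fun _ => rfl }
  rw [← card_exists_isUnit (R := R) (ι := ι), Nat.card_congr e, Nat.card_sigma]
  norm_cast
  rw [Finset.sum_mul, Finset.sum_congr rfl fun y _ => card_pairing_fiber_mul J y.2 hN]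
  simp [Nat.card_eq_fintype_card]

/-- The unimodular pairs `(x, y)` with pairing `N`. -/
abbrev PrimitivePairs (ι : Type*) [Fintype ι] (N : R) :=
  {a : (ι → R) × (ι → R) //
    (∃ i, IsUnit (a.1 i) ∨ IsUnit (a.2 i)) ∧ ∑ i, a.1 i * a.2 i = N}

theorem card_primitivePairs_of_isUnit {N : R} (hN : IsUnit N) :
    (Nat.card (PrimitivePairs ι N) : ℝ) * Nat.card R =
      ((Nat.card R : ℝ) ^ Fintype.card ι - (Nat.card (maximalIdeal R) : ℝ) ^ Fintype.card ι) *
        (Nat.card R : ℝ) ^ Fintype.card ι := by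
  have h := card_pairs_mul (ι := ι) (⊤ : Ideal R) (Submodule.mem_top : N ∈ ⊤)
  have htop : Nat.card (⊤ : Ideal R) = Nat.card R :=
    Nat.card_congr (Equiv.subtypeUnivEquiv fun _ => Submodule.mem_top)
  rw [htop] at h
  rw [← h]
  congr 2
  refine Nat.card_congr (Equiv.subtypeEquivRight fun a => ?_)
  refine ⟨fun ha => ⟨?_, by simp, ha.2⟩, fun ha => ⟨ha.1.imp fun _ => Or.inr, ha.2.2⟩⟩
  by_contra! hc
  refine (mem_maximalIdeal N).1 ?_ hN
  rw [← ha.2]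
  exact Ideal.sum_mem _ fun i _ => Ideal.mul_mem_left _ _ ((mem_maximalIdeal _).2 (hc i))

theorem card_primitivePairs_of_mem {N : R} (hN : N ∈ maximalIdeal R) :
    (Nat.card (PrimitivePairs ι N) : ℝ) * Nat.card R * Nat.card (maximalIdeal R) =
      ((Nat.card R : ℝ) ^ Fintype.card ι - (Nat.card (maximalIdeal R) : ℝ) ^ Fintype.card ι) *
        ((Nat.card R : ℝ) ^ Fintype.card ι * Nat.card (maximalIdeal R) +
          (Nat.card (maximalIdeal R) : ℝ) ^ Fintype.card ι * Nat.card R) := by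
  classical
  have h₁ := card_pairs_mul (ι := ι) (⊤ : Ideal R) (Submodule.mem_top : N ∈ ⊤)
  have h₂ := card_pairs_mul (ι := ι) _ hN
  have htop : Nat.card (⊤ : Ideal R) = Nat.card R :=
    Nat.card_congr (Equiv.subtypeUnivEquiv fun _ => Submodule.mem_top)
  rw [htop] at h₁
  have hsplit := Nat.card_congr
    (Equiv.sumCompl fun a : PrimitivePairs ι N => ∃ i, IsUnit (a.1.2 i))
  rw [Nat.card_sum] at hsplit
  have e₁ : {a : PrimitivePairs ι N // ∃ i, IsUnit (a.1.2 i)} ≃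
      {a : (ι → R) × (ι → R) //
        (∃ i, IsUnit (a.2 i)) ∧ (∀ i, a.1 i ∈ (⊤ : Ideal R)) ∧ ∑ i, a.1 i * a.2 i = N} :=
    (Equiv.subtypeSubtypeEquivSubtypeInter _ fun a : (ι → R) × (ι → R) =>
      ∃ i, IsUnit (a.2 i)).trans
      (Equiv.subtypeEquivRight fun a =>
        ⟨fun ha => ⟨ha.2, by simp, ha.1.2⟩,
          fun ha => ⟨⟨ha.1.imp fun _ => Or.inr, ha.2.2⟩, ha.1⟩⟩)
  have e₂ : {a : PrimitivePairs ι N // ¬ ∃ i, IsUnit (a.1.2 i)} ≃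
      {a : (ι → R) × (ι → R) // (∃ i, IsUnit (a.2 i)) ∧ (∀ i, a.1 i ∈ maximalIdeal R) ∧
        ∑ i, a.1 i * a.2 i = N} :=
    (Equiv.subtypeSubtypeEquivSubtypeInter _ fun a : (ι → R) × (ι → R) =>
      ¬ ∃ i, IsUnit (a.2 i)).trans
      ((Equiv.prodComm _ _).subtypeEquiv fun a => by
        simp only [Equiv.prodComm_apply, Prod.fst_swap, Prod.snd_swap, mem_maximalIdeal,
          mem_nonunits_iff, not_exists]
        refine ⟨fun ha => ⟨?_, ha.2, ?_⟩, fun ha => ⟨⟨ha.1.imp fun _ => Or.inl, ?_⟩, ha.2.1⟩⟩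
        · obtain ⟨i, hi⟩ := ha.1.1
          exact ⟨i, hi.resolve_right (ha.2 i)⟩
        · simpa only [mul_comm] using ha.1.2
        · simpa only [mul_comm] using ha.2.2)
  rw [Nat.card_congr e₁, Nat.card_congr e₂] at hsplit
  rw [← hsplit]
  push_cast
  linear_combination (Nat.card (maximalIdeal R) : ℝ) * h₁ + (Nat.card R : ℝ) * h₂

end LocalRing

section Padic

open IsLocalRing

variable (p : ℕ) [Fact p.Prime]

theorem isLocalRing_zmod_pow {d : ℕ} (hd : d ≠ 0) : IsLocalRing (ZMod (p ^ d)) := by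
  have : Fact (1 < p ^ d) := ⟨Nat.one_lt_pow hd (Fact.out : p.Prime).one_lt⟩
  exact IsLocalRing.of_surjective' (PadicInt.toZModPow (p := p) d) (ZMod.ringHom_surjective _)

theorem card_maximalIdeal_zmod_pow (d : ℕ) [IsLocalRing (ZMod (p ^ (d + 1)))] :
    Nat.card (maximalIdeal (ZMod (p ^ (d + 1)))) = p ^ d := by
  classical
  have hp : p.Prime := Fact.out
  have : NeZero (p ^ (d + 1)) := ⟨pow_ne_zero _ hp.ne_zero⟩
  have h := Nat.card_congr (Equiv.sumCompl fun x : ZMod (p ^ (d + 1)) => IsUnit x)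
  have e : {x : ZMod (p ^ (d + 1)) // ¬ IsUnit x} ≃ maximalIdeal (ZMod (p ^ (d + 1))) :=
    Equiv.subtypeEquivRight fun x => (mem_maximalIdeal x).symm
  have e' : {x : ZMod (p ^ (d + 1)) // IsUnit x} ≃ (ZMod (p ^ (d + 1)))ˣ :=
    (Equiv.ofInjective Units.val Units.val_injective).symm
  rw [Nat.card_sum, Nat.card_congr e, Nat.card_congr e', Nat.card_zmod,
    Nat.card_eq_fintype_card (α := (ZMod _)ˣ), ZMod.card_units_eq_totient,
    Nat.totient_prime_pow_succ hp] at h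
  obtain ⟨k, rfl⟩ : ∃ k, p = k + 1 := ⟨p - 1, by have := hp.pos; omega⟩
  have h' : (k + 1) ^ (d + 1) = (k + 1) ^ d * k + (k + 1) ^ d := by ring
  rw [Nat.add_sub_cancel] at h
  omega

theorem qRed_diagLat (d : ℕ) (N : ℤ_[p]) (x : Fin 1 → ZMod (p ^ d)) :
    qRed p d (diagLat p N) x = PadicInt.toZModPow d N * (x 0 * x 0) := by
  have : NeZero (p ^ d) := ⟨pow_ne_zero _ (Fact.out : p.Prime).ne_zero⟩
  simp [qRed, diagLat, mul_assoc]

theorem qRed_Hplus (d K : ℕ) (v : Fin (2 * K) → ZMod (p ^ d)) :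
    qRed p d (Hplus p K) v =
      ∑ i : Fin K, v ⟨2 * i.1, by have := i.2; omega⟩ * v ⟨2 * i.1 + 1, by have := i.2; omega⟩ := by
  have : NeZero (p ^ d) := ⟨pow_ne_zero _ (Fact.out : p.Prime).ne_zero⟩
  simp [qRed, Hplus]

/-- A column of length `2K` as a pair of vectors of length `K`. -/
def columnEquiv (R : Type*) (K : ℕ) :
    Matrix (Fin (2 * K)) (Fin 1) R ≃ (Fin K → R) × (Fin K → R) where
  toFun T := (fun i => T ⟨2 * i.1, by have := i.2; omega⟩ 0,
    fun i => T ⟨2 * i.1 + 1, by have := i.2; omega⟩ 0)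
  invFun a j _ := if j.1 % 2 = 0 then a.1 ⟨j.1 / 2, by have := j.2; omega⟩
    else a.2 ⟨j.1 / 2, by have := j.2; omega⟩
  left_inv T := by
    ext j k
    obtain rfl := Subsingleton.elim k 0
    dsimp only
    split_ifs with h <;> congr 2 <;> omega
  right_inv a := by
    ext i
    · simp
    · have h : (2 * i.1 + 1) / 2 = i.1 := by omega
      simp [h]

theorem columnEquiv_fst {R : Type*} {K : ℕ} (T : Matrix (Fin (2 * K)) (Fin 1) R) (i : Fin K) :
    (columnEquiv R K T).1 i = T ⟨2 * i.1, by have := i.2; omega⟩ 0 := rfl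

theorem columnEquiv_snd {R : Type*} {K : ℕ} (T : Matrix (Fin (2 * K)) (Fin 1) R) (i : Fin K) :
    (columnEquiv R K T).2 i = T ⟨2 * i.1 + 1, by have := i.2; omega⟩ 0 := rfl

theorem exists_isUnit_columnEquiv_iff {R : Type*} [CommRing R] {K : ℕ}
    (T : Matrix (Fin (2 * K)) (Fin 1) R) :
    (∃ i, IsUnit ((columnEquiv R K T).1 i) ∨ IsUnit ((columnEquiv R K T).2 i)) ↔
      ∃ j, IsUnit (T j 0) := by
  constructor
  · rintro ⟨i, h | h⟩
    exacts [⟨_, h⟩, ⟨_, h⟩]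
  · rintro ⟨j, hj⟩
    refine ⟨⟨j.1 / 2, by have := j.2; omega⟩, ?_⟩
    rcases Nat.mod_two_eq_zero_or_one j.1 with h | h
    · refine Or.inl ?_
      rw [columnEquiv_fst]
      convert hj using 2
      ext
      dsimp only
      omega
    · refine Or.inr ?_
      rw [columnEquiv_snd]
      convert hj using 2
      ext
      dsimp only
      omega

theorem exists_leftInverse_column_iff {R : Type*} [CommRing R] [IsLocalRing R] {m : ℕ}
    (T : Matrix (Fin m) (Fin 1) R) :
    (∃ S : Matrix (Fin 1) (Fin m) R, S * T = 1) ↔ ∃ j, IsUnit (T j 0) := by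
  constructor
  · rintro ⟨S, hS⟩
    by_contra! hc
    have h := congrFun (congrFun hS 0) 0
    rw [Matrix.mul_apply, Matrix.one_apply_eq] at h
    refine (mem_maximalIdeal (1 : R)).1 ?_ isUnit_one
    rw [← h]
    exact Ideal.sum_mem _ fun i _ => Ideal.mul_mem_left _ _ ((mem_maximalIdeal _).2 (hc i))
  · rintro ⟨j, u, hu⟩
    refine ⟨Matrix.of fun _ i => if i = j then (↑u⁻¹ : R) else 0, ?_⟩
    ext a b
    obtain rfl := Subsingleton.elim a 0
    obtain rfl := Subsingleton.elim b 0
    simp [Matrix.mul_apply, ← hu]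

theorem mem_RepSet_iff (d K : ℕ) (N : ℤ_[p])
    (T : Matrix (Fin (2 * K)) (Fin 1) (ZMod (p ^ d))) :
    T ∈ RepSet p (Hplus p K) (diagLat p N) d ↔
      ∑ i, (columnEquiv _ K T).1 i * (columnEquiv _ K T).2 i = PadicInt.toZModPow d N := by
  simp only [RepSet, Set.mem_ofPred_eq, qRed_diagLat, qRed_Hplus, Matrix.mulVec, dotProduct,
    Fin.sum_univ_one, Fin.isValue, columnEquiv_fst, columnEquiv_snd]
  constructor
  · intro h
    simpa using h 1
  · intro h x
    rw [← h, Finset.sum_mul]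
    exact Finset.sum_congr rfl fun i _ => by ring

theorem ncard_PRepSet (d K : ℕ) (N : ℤ_[p]) [IsLocalRing (ZMod (p ^ d))] :
    (PRepSet p (Hplus p K) (diagLat p N) d).ncard =
      Nat.card (PrimitivePairs (Fin K) (PadicInt.toZModPow d N)) := by
  rw [← Nat.card_coe_set_eq]
  refine Nat.card_congr ((columnEquiv _ K).subtypeEquiv fun T => ?_)
  rw [exists_isUnit_columnEquiv_iff, ← mem_RepSet_iff, ← exists_leftInverse_column_iff, and_comm]
  rfl

theorem hasPden_of_ncard_mul_eq {K : ℕ} {N : ℤ_[p]} {D : ℝ}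
    (h : ∀ d : ℕ, ((PRepSet p (Hplus p K) (diagLat p N) (d + 1)).ncard : ℝ) *
      (p : ℝ) ^ (d + 1) = D * ((p : ℝ) ^ (d + 1)) ^ (2 * K)) :
    HasPden p (Hplus p K) (diagLat p N) D := by
  have hp : (p : ℝ) ≠ 0 := Nat.cast_ne_zero.2 (Fact.out : p.Prime).ne_zero
  refine tendsto_const_nhds.congr' ?_
  filter_upwards [eventually_ne_atTop 0] with d hd
  obtain ⟨d, rfl⟩ := Nat.exists_eq_succ_of_ne_zero hd
  rw [eq_div_iff (zpow_ne_zero _ hp), ← mul_left_inj' (pow_ne_zero (d + 1) hp), Nat.succ_eq_add_one,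
    h d, mul_assoc, ← zpow_natCast (p : ℝ) (d + 1), ← zpow_add₀ hp, ← zpow_natCast, ← zpow_mul]
  congr 2
  push_cast
  norm_num
  ring

end Padic

/-- for `K ≥ 1` and `N ∈ ℤ_p`: if `p ∣ N` then
`Pden(H_{2K}^+, ⟨N⟩) = (1 − p^{−K})(1 + p^{1−K})`, and if `N` is a unit then
`Pden(H_{2K}^+, ⟨N⟩) = 1 − p^{−K}`; in particular these primitive local densities exist. -/
theorem statement6 (p : ℕ) [Fact p.Prime] (K : ℕ) (hK : 1 ≤ K) (N : ℤ_[p]) :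
    ((p : ℤ_[p]) ∣ N →
      HasPden p (Hplus p K) (diagLat p N)
        ((1 - (p : ℝ) ^ (-(K : ℤ))) * (1 + (p : ℝ) ^ (1 - (K : ℤ))))) ∧
    (IsUnit N →
      HasPden p (Hplus p K) (diagLat p N) (1 - (p : ℝ) ^ (-(K : ℤ)))) := by
  have hp : (p : ℝ) ≠ 0 := Nat.cast_ne_zero.2 (Fact.out : p.Prime).ne_zero
  refine ⟨fun hN => hasPden_of_ncard_mul_eq p fun d => ?_,
    fun hN => hasPden_of_ncard_mul_eq p fun d => ?_⟩
  all_goals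
    have : NeZero (p ^ (d + 1)) := ⟨pow_ne_zero _ (Fact.out : p.Prime).ne_zero⟩
    have := isLocalRing_zmod_pow p d.succ_ne_zero
    rw [ncard_PRepSet]
  · have hmem : PadicInt.toZModPow (d + 1) N ∈
        IsLocalRing.maximalIdeal (ZMod (p ^ (d + 1))) := by
      obtain ⟨M, rfl⟩ := hN
      rw [map_mul, map_natCast]
      refine Ideal.mul_mem_right _ _ ((IsLocalRing.mem_maximalIdeal _).2 fun hu => ?_)
      have h := hu.pow (d + 1)
      rw [← Nat.cast_pow, ZMod.natCast_self] at h
      exact not_isUnit_zero h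
    have h := card_primitivePairs_of_mem (ι := Fin K) hmem
    rw [card_maximalIdeal_zmod_pow, Nat.card_zmod, Fintype.card_fin] at h
    push_cast at h
    rw [← mul_left_inj' (pow_ne_zero d hp), h, zpow_sub₀ hp, zpow_neg, zpow_one, zpow_natCast]
    field_simp
    ring
  · have h := card_primitivePairs_of_isUnit (ι := Fin K)
      (hN.map (PadicInt.toZModPow (p := p) (d + 1)))
    rw [card_maximalIdeal_zmod_pow, Nat.card_zmod, Fintype.card_fin] at h
    push_cast at h
    rw [h, zpow_neg, zpow_natCast]
    field_simp
    ring

end PaperStmt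
end

section
/- Let N be a positive integer, p a prime dividing N, and t a positive integer such that pt divides N. Then a_N(pt) = p · a_{N/p}(t). -/
namespace PaperStmt

/-- `a_N(t) = Σ_{r ∣ t} μ(t/r)·μ(N/r)·φ(N)/φ(N/r)` (the divisions are exact when `t ∣ N`,
resp. when `t·p ∣ N` in Statement 7). -/
def aN (N t : ℕ) : ℤ :=
  ∑ r ∈ t.divisors, ArithmeticFunction.moebius (t / r) * ArithmeticFunction.moebius (N / r) *
    ((N.totient / (N / r).totient : ℕ) : ℤ)


/-- A sum over the divisors of `p * t`, split according to divisibility by the prime `p`. -/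
lemma sum_divisors_prime_mul {p t : ℕ} (hp : p.Prime) (ht : 0 < t) (f : ℕ → ℤ) :
    ∑ r ∈ (p * t).divisors, f r =
      ∑ s ∈ t.divisors, f (p * s) + ∑ r ∈ t.divisors with ¬ p ∣ r, f r := by
  rw [← Finset.sum_filter_add_sum_filter_not (p * t).divisors (p ∣ ·)]
  congr 1
  · symm
    refine Finset.sum_nbij (p * ·) ?_ ?_ ?_ fun _ _ ↦ rfl
    · intro s hs
      have h := Nat.dvd_of_mem_divisors hs
      simp [Nat.mul_dvd_mul_left p h, hp.ne_zero, ht.ne']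
    · intro a _ b _ h
      exact Nat.eq_of_mul_eq_mul_left hp.pos h
    · intro r hr
      simp only [Finset.coe_filter, Nat.mem_divisors, Set.mem_ofPred_eq] at hr
      obtain ⟨⟨h, _⟩, s, rfl⟩ := hr
      exact ⟨s, by simp [Nat.dvd_of_mul_dvd_mul_left hp.pos h, ht.ne'], rfl⟩
  · refine Finset.sum_congr ?_ fun _ _ ↦ rfl
    ext r
    simp only [Finset.mem_filter, Nat.mem_divisors]
    constructor
    · rintro ⟨⟨h, _⟩, hr⟩
      exact ⟨⟨((hp.coprime_iff_not_dvd.2 hr).symm).dvd_of_dvd_mul_left h, ht.ne'⟩, hr⟩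
    · rintro ⟨⟨h, _⟩, hr⟩
      exact ⟨⟨h.mul_left p, (Nat.mul_pos hp.pos ht).ne'⟩, hr⟩

lemma moebius_prime_mul {p n : ℕ} (hp : p.Prime) (h : ¬ p ∣ n) :
    ArithmeticFunction.moebius (p * n) = -ArithmeticFunction.moebius n := by
  rw [ArithmeticFunction.isMultiplicative_moebius.map_mul_of_coprime
    (hp.coprime_iff_not_dvd.2 h), ArithmeticFunction.moebius_apply_prime hp, neg_one_mul]

lemma moebius_prime_mul_of_dvd {p n : ℕ} (hp : p.Prime) (h : p ∣ n) :
    ArithmeticFunction.moebius (p * n) = 0 := by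
  refine ArithmeticFunction.moebius_eq_zero_of_not_squarefree fun hsq ↦ ?_
  exact hp.one_lt.ne' (Nat.isUnit_iff.1 (hsq p (Nat.mul_dvd_mul_left p h)))

/-- if `p` is a prime dividing `N` and `t > 0` with `p·t ∣ N`, then
`a_N(p·t) = p · a_{N/p}(t)`. -/
theorem statement7 (N p t : ℕ) (hN : 0 < N) (hp : p.Prime) (hpN : p ∣ N)
    (ht : 0 < t) (hpt : p * t ∣ N) :
    aN N (p * t) = (p : ℤ) * aN (N / p) t := by
  obtain ⟨M, rfl⟩ := hpN
  have htM : t ∣ M := Nat.dvd_of_mul_dvd_mul_left hp.pos hpt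
  rw [Nat.mul_div_cancel_left M hp.pos, aN, sum_divisors_prime_mul hp ht, aN, Finset.mul_sum]
  simp only [Nat.mul_div_mul_left _ _ hp.pos]
  by_cases hpM : p ∣ M
  · rw [Finset.sum_eq_zero (s := {r ∈ t.divisors | ¬ p ∣ r}), add_zero]
    · refine Finset.sum_congr rfl fun s hs ↦ ?_
      have hsM := (Nat.dvd_of_mem_divisors hs).trans htM
      rw [Nat.totient_mul_of_prime_of_dvd hp hpM,
        Nat.mul_div_assoc _ (Nat.totient_dvd_of_dvd (Nat.div_dvd_of_dvd hsM))]
      push_cast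
      ring
    · intro r hr
      obtain ⟨hr, hpr⟩ := Finset.mem_filter.1 hr
      have hrM := (Nat.dvd_of_mem_divisors hr).trans htM
      have hpd : p ∣ M / r :=
        (hp.coprime_iff_not_dvd.2 hpr).dvd_of_dvd_mul_left (by rwa [Nat.mul_div_cancel' hrM])
      rw [Nat.mul_div_assoc _ hrM, moebius_prime_mul_of_dvd hp hpd]
      simp
  · have hcop (r : ℕ) (hr : r ∈ t.divisors) : ¬ p ∣ r := fun h ↦
      hpM (h.trans ((Nat.dvd_of_mem_divisors hr).trans htM))
    rw [Finset.filter_true_of_mem hcop, ← Finset.sum_add_distrib]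
    refine Finset.sum_congr rfl fun s hs ↦ ?_
    have hst := Nat.dvd_of_mem_divisors hs
    have hsM := hst.trans htM
    have hM : ¬ p ∣ M / s := fun h ↦ hpM (h.trans (Nat.div_dvd_of_dvd hsM))
    have hT : ¬ p ∣ t / s := fun h ↦ hpM (h.trans ((Nat.div_dvd_of_dvd hst).trans htM))
    rw [Nat.mul_div_assoc _ hst, Nat.mul_div_assoc _ hsM, moebius_prime_mul hp hM,
      moebius_prime_mul hp hT, Nat.totient_mul_of_prime_of_not_dvd hp hpM,
      Nat.totient_mul_of_prime_of_not_dvd hp hM,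
      Nat.mul_div_mul_left _ _ (Nat.sub_pos_of_lt hp.one_lt),
      Nat.mul_div_assoc _ (Nat.totient_dvd_of_dvd (Nat.div_dvd_of_dvd hsM))]
    push_cast [hp.one_le]
    ring

end PaperStmt
end

section
/- For every positive integer N one has Σ_{t ∣ N} a_N(t) = φ(N), and for every integer N ≥ 2 one has Σ_{t ∣ N} a_N(t)/t = 0 (an identity in ℚ). -/
namespace PaperStmt

open ArithmeticFunction in
theorem sum_moebius_divisors {R : Type*} [Ring R] (n : ℕ) :
    ∑ d ∈ n.divisors, (moebius d : R) = if n = 1 then 1 else 0 := by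
  have h : ∑ d ∈ n.divisors, moebius d = if n = 1 then 1 else 0 := by
    rw [← coe_zeta_mul_apply, coe_zeta_mul_moebius, one_apply]
  have h' := congrArg (Int.cast : ℤ → R) h
  push_cast at h'
  exact h'

open ArithmeticFunction in
theorem sum_moebius_div_divisors (n : ℕ) (hn : 0 < n) :
    ∑ d ∈ n.divisors, (moebius d : ℚ) / d = n.totient / n := by
  have h := (sum_eq_iff_sum_mul_moebius_eq (R := ℚ) (f := fun k => (k.totient : ℚ))
    (g := fun k => (k : ℚ))).1 (fun k _ => by exact_mod_cast k.sum_totient) n hn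
  rw [← h, Nat.sum_divisorsAntidiagonal (fun i j => (moebius i : ℚ) * (j : ℚ)), Finset.sum_div]
  refine Finset.sum_congr rfl fun d hd => ?_
  have hdn := Nat.dvd_of_mem_divisors hd
  have hd0 : (d : ℚ) ≠ 0 := by exact_mod_cast (Nat.pos_of_mem_divisors hd).ne'
  have hn0 : (n : ℚ) ≠ 0 := by exact_mod_cast hn.ne'
  rw [Nat.cast_div hdn hd0]
  field_simp

theorem sum_divisors_sum_divisors {M : Type*} [AddCommMonoid M] (n : ℕ) (F : ℕ → ℕ → M) :
    ∑ t ∈ n.divisors, ∑ r ∈ t.divisors, F r (t / r) =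
      ∑ r ∈ n.divisors, ∑ s ∈ (n / r).divisors, F r s := by
  rw [Finset.sum_sigma', Finset.sum_sigma']
  refine Finset.sum_nbij' (fun x => ⟨x.2, x.1 / x.2⟩) (fun x => ⟨x.1 * x.2, x.1⟩) ?_ ?_ ?_ ?_ ?_
  · rintro ⟨t, r⟩ h
    simp only [Finset.mem_sigma, Nat.mem_divisors] at h ⊢
    obtain ⟨⟨⟨c, rfl⟩, hn⟩, ⟨b, rfl⟩, ht⟩ := h
    have hr : 0 < r := Nat.pos_of_ne_zero (left_ne_zero_of_mul ht)
    rw [mul_assoc, Nat.mul_div_cancel_left _ hr, Nat.mul_div_cancel_left _ hr]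
    rw [mul_assoc] at hn
    exact ⟨⟨dvd_mul_right _ _, hn⟩, dvd_mul_right _ _, right_ne_zero_of_mul hn⟩
  · rintro ⟨r, s⟩ h
    simp only [Finset.mem_sigma, Nat.mem_divisors] at h ⊢
    obtain ⟨⟨⟨c, rfl⟩, hn⟩, hs, hc⟩ := h
    have hr : 0 < r := Nat.pos_of_ne_zero (left_ne_zero_of_mul hn)
    rw [Nat.mul_div_cancel_left _ hr] at hs hc
    exact ⟨⟨mul_dvd_mul_left _ hs, hn⟩, dvd_mul_right _ _,
      mul_ne_zero hr.ne' (ne_zero_of_dvd_ne_zero hc hs)⟩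
  · rintro ⟨t, r⟩ h
    simp only [Finset.mem_sigma, Nat.mem_divisors] at h
    simp [Nat.mul_div_cancel' h.2.1]
  · rintro ⟨r, s⟩ h
    simp only [Finset.mem_sigma, Nat.mem_divisors] at h
    have hr : 0 < r := Nat.pos_of_dvd_of_pos h.1.1 (Nat.pos_of_ne_zero h.1.2)
    simp [Nat.mul_div_cancel_left _ hr]
  · rintro ⟨t, r⟩ _
    rfl

theorem cast_totient_div_totient {n d : ℕ} (hd : d ∣ n) (hn : 0 < n) :
    ((n.totient / d.totient : ℕ) : ℚ) = n.totient / d.totient :=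
  Nat.cast_div (Nat.totient_dvd_of_dvd hd)
    (by exact_mod_cast (Nat.totient_pos.2 (Nat.pos_of_dvd_of_pos hd hn)).ne')

open ArithmeticFunction in
theorem sum_aN (N : ℕ) (hN : 0 < N) : ∑ t ∈ N.divisors, aN N t = (N.totient : ℤ) := by
  unfold aN
  rw [sum_divisors_sum_divisors N (fun r s => moebius s * moebius (N / r) *
    ((N.totient / (N / r).totient : ℕ) : ℤ)),
    Nat.sum_div_divisors N (fun d => ∑ s ∈ d.divisors, moebius s * moebius d *
    ((N.totient / d.totient : ℕ) : ℤ))]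
  simp_rw [mul_assoc, ← Finset.sum_mul]
  rw [Finset.sum_eq_single_of_mem 1 (Nat.one_mem_divisors.2 hN.ne')]
  · simp
  · intro d _ hd1
    have h := sum_moebius_divisors (R := ℤ) d
    simp only [Int.cast_id, if_neg hd1] at h
    rw [h, zero_mul]

open ArithmeticFunction in
theorem sum_aN_div (N : ℕ) (hN : 2 ≤ N) :
    ∑ t ∈ N.divisors, (aN N t : ℚ) / (t : ℚ) = 0 := by
  have expand : ∀ t ∈ N.divisors, (aN N t : ℚ) / (t : ℚ) = ∑ r ∈ t.divisors,
      (moebius (t / r) : ℚ) / ((t / r : ℕ) : ℚ) *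
        ((moebius (N / r) : ℚ) * ((N.totient / (N / r).totient : ℕ) : ℚ) / r) := by
    intro t _
    simp only [aN, Int.cast_sum, Int.cast_mul, Int.cast_natCast]
    rw [Finset.sum_div]
    refine Finset.sum_congr rfl fun r hr => ?_
    have h : (t : ℚ) = (r : ℚ) * ((t / r : ℕ) : ℚ) := by
      exact_mod_cast (Nat.mul_div_cancel' (Nat.dvd_of_mem_divisors hr)).symm
    rw [h, mul_assoc, mul_comm (r : ℚ), mul_div_mul_comm]
  rw [Finset.sum_congr rfl expand, sum_divisors_sum_divisors N (fun r s =>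
    (moebius s : ℚ) / (s : ℚ) *
      ((moebius (N / r) : ℚ) * ((N.totient / (N / r).totient : ℕ) : ℚ) / r))]
  have inner : ∀ r ∈ N.divisors, ∑ s ∈ (N / r).divisors, (moebius s : ℚ) / (s : ℚ) *
      ((moebius (N / r) : ℚ) * ((N.totient / (N / r).totient : ℕ) : ℚ) / r) =
      (moebius (N / r) : ℚ) * (N.totient / N) := by
    intro r hr
    have hrN := Nat.dvd_of_mem_divisors hr
    have hd : 0 < N / r := Nat.div_pos (Nat.divisor_le hr) (Nat.pos_of_mem_divisors hr)
    have hr0 : (r : ℚ) ≠ 0 := by exact_mod_cast (Nat.pos_of_mem_divisors hr).ne'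
    have hφ : ((N / r).totient : ℚ) ≠ 0 := by exact_mod_cast (Nat.totient_pos.2 hd).ne'
    rw [← Finset.sum_mul, sum_moebius_div_divisors _ hd,
      cast_totient_div_totient (Nat.div_dvd_of_dvd hrN) (by omega), Nat.cast_div hrN hr0]
    field_simp
  rw [Finset.sum_congr rfl inner, ← Finset.sum_mul,
    Nat.sum_div_divisors N (fun d => (moebius d : ℚ)), sum_moebius_divisors N,
    if_neg (by omega), zero_mul]

/-- `Σ_{t ∣ N} a_N(t) = φ(N)` for every `N ≥ 1`, and
`Σ_{t ∣ N} a_N(t)/t = 0` in `ℚ` for every `N ≥ 2`. -/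
theorem statement8 :
    (∀ N : ℕ, 0 < N → ∑ t ∈ N.divisors, aN N t = (N.totient : ℤ)) ∧
    (∀ N : ℕ, 2 ≤ N → ∑ t ∈ N.divisors, (aN N t : ℚ) / (t : ℚ) = 0) :=
  ⟨sum_aN, sum_aN_div⟩

end PaperStmt
end

section
/- Let N be a positive integer, p a prime dividing N, n = v_p(N) ≥ 1 the p-adic valuation of N, and N_p = N·p^{−n}. Then for every z in the upper half-plane ℍ, Δ_N(z) = Δ_{N_p}(p^n z)^{p^n} · Δ_{N_p}(p^{n−1} z)^{−p^{n−1}}. -/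
namespace PaperStmt

/-- The modular discriminant `Δ(z) = q·Π_{n≥1}(1 − q^n)^24`, `q = e^{2πiz}`, for `Im z > 0`. -/
noncomputable def Disc (z : ℂ) : ℂ :=
  Complex.exp (2 * (Real.pi : ℂ) * Complex.I * z) *
    ∏' n : ℕ, (1 - Complex.exp (2 * (Real.pi : ℂ) * Complex.I * z) ^ (n + 1)) ^ 24

/-- `Δ_M(z) = Π_{t ∣ M} Δ(tz)^{a_M(t)}`. -/
noncomputable def DiscN (M : ℕ) (z : ℂ) : ℂ :=
  ∏ t ∈ M.divisors, Disc ((t : ℂ) * z) ^ aN M t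


theorem prod_divisors_mul_of_coprime {α : Type*} [CommMonoid α] {m n : ℕ} (hmn : m.Coprime n)
    (f : ℕ → α) :
    ∏ d ∈ (m * n).divisors, f d = ∏ a ∈ m.divisors, ∏ b ∈ n.divisors, f (a * b) := by
  have h : (m * n).divisors = (m.divisors ×ˢ n.divisors).image fun x ↦ x.1 * x.2 := by
    ext d
    simp [Nat.divisors_mul, Finset.mem_mul, and_assoc]
  rw [h, Finset.prod_image hmn.mul_injOn_divisors, Finset.prod_product]

theorem sum_divisors_mul_of_coprime {α : Type*} [AddCommMonoid α] {m n : ℕ} (hmn : m.Coprime n)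
    (f : ℕ → α) :
    ∑ d ∈ (m * n).divisors, f d = ∑ a ∈ m.divisors, ∑ b ∈ n.divisors, f (a * b) :=
  prod_divisors_mul_of_coprime (α := Multiplicative α) hmn f

/-- `a_N(t)` is multiplicative in the pair `(N, t)`. -/
theorem aN_mul {A B a b : ℕ} (hAB : A.Coprime B) (ha : a ∣ A) (hb : b ∣ B) :
    aN (A * B) (a * b) = aN A a * aN B b := by
  have hab : a.Coprime b := (hAB.coprime_dvd_left ha).coprime_dvd_right hb
  rw [aN, sum_divisors_mul_of_coprime hab, aN, aN, Finset.sum_mul_sum]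
  refine Finset.sum_congr rfl fun r hr ↦ Finset.sum_congr rfl fun s hs ↦ ?_
  have hra := Nat.dvd_of_mem_divisors hr
  have hsb := Nat.dvd_of_mem_divisors hs
  have hrA := hra.trans ha
  have hsB := hsb.trans hb
  have h₁ : (a / r).Coprime (b / s) :=
    (hab.coprime_dvd_left (Nat.div_dvd_of_dvd hra)).coprime_dvd_right (Nat.div_dvd_of_dvd hsb)
  have h₂ : (A / r).Coprime (B / s) :=
    (hAB.coprime_dvd_left (Nat.div_dvd_of_dvd hrA)).coprime_dvd_right (Nat.div_dvd_of_dvd hsB)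
  rw [← Nat.div_mul_div_comm hra hsb, ← Nat.div_mul_div_comm hrA hsB,
    ArithmeticFunction.isMultiplicative_moebius.map_mul_of_coprime h₁,
    ArithmeticFunction.isMultiplicative_moebius.map_mul_of_coprime h₂,
    Nat.totient_mul hAB, Nat.totient_mul h₂,
    ← Nat.div_mul_div_comm (Nat.totient_dvd_of_dvd (Nat.div_dvd_of_dvd hrA))
      (Nat.totient_dvd_of_dvd (Nat.div_dvd_of_dvd hsB))]
  push_cast
  ring

theorem aN_prime_pow {p : ℕ} (hp : p.Prime) {k i : ℕ} (hi : i ≤ k + 1) :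
    aN (p ^ (k + 1)) (p ^ i) =
      if i = k + 1 then (p : ℤ) ^ (k + 1) else if i = k then -(p : ℤ) ^ k else 0 := by
  have htot : ((p ^ (k + 1)).totient : ℤ) = (p : ℤ) ^ k * ((p : ℤ) - 1) := by
    rw [Nat.totient_prime_pow_succ hp, Nat.cast_mul, Nat.cast_pow, Nat.cast_sub hp.one_le,
      Nat.cast_one]
  have hquot : ((p ^ (k + 1)).totient : ℤ) / p.totient = (p : ℤ) ^ k := by
    norm_cast
    rw [Nat.totient_prime_pow_succ hp, Nat.totient_prime hp,
      Nat.mul_div_cancel _ (Nat.sub_pos_of_lt hp.one_lt)]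
  have hdiv (m j : ℕ) (hj : j ≤ m) : p ^ m / p ^ j = p ^ (m - j) := Nat.pow_div hj hp.pos
  rw [aN, Nat.sum_divisors_prime_pow hp]
  have hvanish (m : ℕ) (hm : 2 ≤ m) : ArithmeticFunction.moebius (p ^ m) = 0 := by
    rw [ArithmeticFunction.moebius_apply_prime_pow hp (by lia), if_neg (by lia)]
  have hzero (j : ℕ) (hj : j < k) (x : ℤ) (y : ℕ) :
      x * ArithmeticFunction.moebius (p ^ (k + 1) / p ^ j) * (y : ℤ) = 0 := by
    rw [hdiv _ _ (by lia), hvanish _ (by lia)]; simp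
  rcases (show i < k ∨ i = k ∨ i = k + 1 by lia) with h | rfl | rfl
  · rw [if_neg (by lia), if_neg (by lia)]
    exact Finset.sum_eq_zero fun j hj ↦ hzero j (by simp at hj; lia) _ _
  · rw [Finset.sum_range_succ,
      Finset.sum_eq_zero fun j hj ↦ hzero j (by simpa using hj) _ _]
    simp [hdiv, hquot, ArithmeticFunction.moebius_apply_prime hp]
  · rw [Finset.sum_range_succ, Finset.sum_range_succ,
      Finset.sum_eq_zero fun j hj ↦ hzero j (by simpa using hj) _ _]
    simp only [hdiv _ _ le_rfl, hdiv _ _ (Nat.le_add_right k 1), Nat.sub_self, Nat.add_sub_cancel_left, pow_zero,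
      pow_one, ArithmeticFunction.moebius_apply_one, ArithmeticFunction.moebius_apply_prime hp,
      Nat.totient_one, Nat.div_one, Int.natCast_ediv, hquot, if_true]
    rw [htot]
    ring

theorem discN_prime_pow_mul {p k M : ℕ} (hp : p.Prime) (hM : p.Coprime M) (z : ℂ) :
    DiscN (p ^ (k + 1) * M) z = DiscN M ((p : ℂ) ^ (k + 1) * z) ^ ((p : ℤ) ^ (k + 1)) *
      DiscN M ((p : ℂ) ^ k * z) ^ (-(p : ℤ) ^ k) := by
  have hco : (p ^ (k + 1)).Coprime M := hM.pow_left _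
  have hfactor (i : ℕ) (hi : i ≤ k + 1) :
      ∏ s ∈ M.divisors, Disc (((p ^ i * s : ℕ) : ℂ) * z) ^ aN (p ^ (k + 1) * M) (p ^ i * s) =
        DiscN M ((p : ℂ) ^ i * z) ^ aN (p ^ (k + 1)) (p ^ i) := by
    rw [DiscN, ← Finset.prod_zpow]
    refine Finset.prod_congr rfl fun s hs ↦ ?_
    rw [aN_mul hco (pow_dvd_pow p hi) (Nat.dvd_of_mem_divisors hs), mul_comm (aN _ _), zpow_mul]
    push_cast
    rw [mul_left_comm, mul_assoc, mul_left_comm]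
  rw [DiscN, prod_divisors_mul_of_coprime hco, Nat.prod_divisors_prime_pow hp,
    Finset.prod_range_succ, Finset.prod_range_succ,
    Finset.prod_eq_one, hfactor _ le_rfl, hfactor _ k.le_succ, aN_prime_pow hp le_rfl,
    aN_prime_pow hp k.le_succ]
  · simp [mul_comm]
  · intro i hi
    have hi : i < k := by simpa using hi
    rw [hfactor i (by lia), aN_prime_pow hp (by lia), if_neg (by lia), if_neg (by lia), zpow_zero]

/-- for `p ∣ N`, `n = v_p(N) ≥ 1`, `N_p = N·p^{−n}`, and `z` in the upper
half-plane, `Δ_N(z) = Δ_{N_p}(p^n z)^{p^n} · Δ_{N_p}(p^{n−1} z)^{−p^{n−1}}`. -/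
theorem statement10 (N p : ℕ) (hN : 0 < N) (hp : p.Prime) (hpN : p ∣ N)
    (n : ℕ) (hn : n = padicValNat p N) (Np : ℕ) (hNp : Np = N / p ^ n)
    (z : ℂ) (hz : 0 < z.im) :
    DiscN N z = DiscN Np ((p : ℂ) ^ n * z) ^ ((p : ℤ) ^ n) *
      DiscN Np ((p : ℂ) ^ (n - 1) * z) ^ (-(p : ℤ) ^ (n - 1)) := by
  subst hn hNp
  have : Fact p.Prime := ⟨hp⟩
  obtain ⟨k, hk⟩ : ∃ k, padicValNat p N = k + 1 :=
    Nat.exists_eq_succ_of_ne_zero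
      (Nat.one_le_iff_ne_zero.mp (one_le_padicValNat_of_dvd hN.ne' hpN))
  have hdvd : p ^ (k + 1) ∣ N := hk ▸ pow_padicValNat_dvd
  have hco : p.Coprime (N / p ^ (k + 1)) := by
    have h := Nat.coprime_ordCompl hp hN.ne'
    rwa [Nat.factorization_def N hp, hk] at h
  rw [hk, Nat.add_sub_cancel, ← discN_prime_pow_mul hp hco, Nat.mul_div_cancel' hdvd]

end PaperStmt
end

section
/- Let N be a positive integer. Then for every z in the upper half-plane ℍ, Δ_N(−1/z) = z^{12·φ(N)} · (Π_{t ∣ N} t^{−12·a_N(t)}) · Π_{t ∣ N} Δ(z/t)^{a_N(t)}. -/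
namespace PaperStmt

/-- The divisor sum of the exponents: `Σ_{t ∣ N} a_N(t) = φ(N)`. -/
theorem sum_divisors_aN {N : ℕ} (hN : 0 < N) : ∑ t ∈ N.divisors, aN N t = N.totient := by
  have h := (ArithmeticFunction.sum_eq_iff_sum_mul_moebius_eq (f := aN N)
    (g := fun r ↦ ArithmeticFunction.moebius (N / r) *
      ((N.totient / (N / r).totient : ℕ) : ℤ))).2 (fun t _ ↦ by
        simp only [Int.cast_id]
        rw [Nat.sum_divisorsAntidiagonal' (f := fun d r ↦ ArithmeticFunction.moebius d *
          (ArithmeticFunction.moebius (N / r) * ((N.totient / (N / r).totient : ℕ) : ℤ)))]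
        simp only [aN, mul_assoc]) N hN
  simpa [Nat.div_self hN] using h

theorem prod_zpow_eq_zpow_sum {ι K : Type*} [CommGroupWithZero K] {x : K} (hx : x ≠ 0)
    (s : Finset ι) (f : ι → ℤ) : ∏ i ∈ s, x ^ f i = x ^ ∑ i ∈ s, f i := by
  classical
  induction s using Finset.induction_on with
  | empty => simp
  | insert i s hi ih => rw [Finset.prod_insert hi, Finset.sum_insert hi, ih, zpow_add₀ hx]

theorem disc_eq_discriminant (τ : UpperHalfPlane) : Disc τ = ModularForm.discriminant τ := by
  simp [Disc, ModularForm.discriminant_eq_q_prod, ModularForm.eta_q, Function.Periodic.qParam]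

/-- The transformation law of the discriminant under `z ↦ -1/z`. -/
theorem disc_neg_one_div {z : ℂ} (hz : 0 < z.im) : Disc (-1 / z) = z ^ 12 * Disc z := by
  let τ : UpperHalfPlane := ⟨z, hz⟩
  have hz0 : z ≠ 0 := τ.ne_zero
  have h := congrFun ModularForm.discriminant_S_invariant τ
  rw [ModularForm.SL_slash_apply, UpperHalfPlane.modular_S_smul, ← disc_eq_discriminant,
    ← disc_eq_discriminant, ModularGroup.denom_S] at h
  change Disc (-z)⁻¹ * z ^ (-12 : ℤ) = Disc z at h
  rw [← h, show -1 / z = (-z)⁻¹ by rw [inv_neg, neg_div, one_div], mul_left_comm,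
    ← zpow_natCast z 12, ← zpow_add₀ hz0]
  simp

/-- for every `N ≥ 1` and `z` in the upper half-plane,
`Δ_N(−1/z) = z^{12φ(N)} · (Π_{t ∣ N} t^{−12·a_N(t)}) · Π_{t ∣ N} Δ(z/t)^{a_N(t)}`. -/
theorem statement11 (N : ℕ) (hN : 0 < N) (z : ℂ) (hz : 0 < z.im) :
    DiscN N (-1 / z) = z ^ (12 * N.totient) *
      (∏ t ∈ N.divisors, (t : ℂ) ^ (-(12 * aN N t))) *
      ∏ t ∈ N.divisors, Disc (z / (t : ℂ)) ^ aN N t := by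
  have hz0 : z ≠ 0 := by
    rintro rfl
    simp at hz
  have hpow : z ^ (12 * N.totient) = ∏ t ∈ N.divisors, z ^ (12 * aN N t) := by
    rw [prod_zpow_eq_zpow_sum hz0, ← Finset.mul_sum, sum_divisors_aN hN, ← zpow_natCast]
    push_cast
    rfl
  rw [hpow, ← Finset.prod_mul_distrib, ← Finset.prod_mul_distrib, DiscN]
  refine Finset.prod_congr rfl fun t ht ↦ ?_
  have ht0 : 0 < t := Nat.pos_of_mem_divisors ht
  have him : 0 < (z / (t : ℂ)).im := by
    rw [Complex.div_natCast_im]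
    positivity
  rw [show (t : ℂ) * (-1 / z) = -1 / (z / t) by field_simp, disc_neg_one_div him, mul_zpow,
    div_pow, div_zpow, zpow_neg, zpow_mul, zpow_mul, div_eq_mul_inv]
  norm_cast

end PaperStmt
end
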